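/- arXiv:2504.04607 — 6 statements merged into one kernel-verified Lean document; each statement's English description precedes it below -/
import Mathlib

section
/- Let L > 0, let p, f : ℝ → ℝ be continuous on [0, L], and let λ ∈ ℝ. Suppose u, u⁰ : ℝ → ℝ are twice continuously differentiable on [0, L] and satisfy -u''(x) + p(x) u(x) + λ u(x) = f(x) and -(u⁰)''(x) + λ u⁰(x) = f(x) for all x ∈ [0, L], together with the Neumann boundary conditions u'(0) = u'(L) = 0 and (u⁰)'(0) = (u⁰)'(L) = 0. Then ∫₀ᴸ f(x) u⁰(x) dx − ∫₀ᴸ f(x) u(x) dx = ∫₀ᴸ p(x) u(x) u⁰(x) dx. -/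
/-- Lagrange's identity on `[a, b]`: the integral of `u'' v - u v''` is the increment of the
Wronskian `u' v - u v'`. -/
theorem integral_deriv_deriv_mul_sub_mul_deriv_deriv {a b : ℝ} (hab : a ≤ b)
    {u u' u'' v v' v'' : ℝ → ℝ}
    (hu : ∀ x ∈ Set.Icc a b, HasDerivWithinAt u (u' x) (Set.Icc a b) x)
    (hu' : ∀ x ∈ Set.Icc a b, HasDerivWithinAt u' (u'' x) (Set.Icc a b) x)
    (hu'' : ContinuousOn u'' (Set.Icc a b))
    (hv : ∀ x ∈ Set.Icc a b, HasDerivWithinAt v (v' x) (Set.Icc a b) x)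
    (hv' : ∀ x ∈ Set.Icc a b, HasDerivWithinAt v' (v'' x) (Set.Icc a b) x)
    (hv'' : ContinuousOn v'' (Set.Icc a b)) :
    ∫ x in a..b, (u'' x * v x - u x * v'' x) =
      (u' b * v b - u b * v' b) - (u' a * v a - u a * v' a) := by
  have hW : ∀ x ∈ Set.Icc a b, HasDerivWithinAt (fun y => u' y * v y - u y * v' y)
      (u'' x * v x - u x * v'' x) (Set.Icc a b) x := fun x hx =>
    (((hu' x hx).mul (hv x hx)).sub ((hu x hx).mul (hv' x hx))).congr_deriv (by ring)
  have huc : ContinuousOn u (Set.Icc a b) := HasDerivWithinAt.continuousOn hu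
  have hvc : ContinuousOn v (Set.Icc a b) := HasDerivWithinAt.continuousOn hv
  exact intervalIntegral.integral_eq_sub_of_hasDerivAt_of_le hab
    (HasDerivWithinAt.continuousOn hW)
    (fun x hx => (hW x (Set.Ioo_subset_Icc_self hx)).hasDerivAt (Icc_mem_nhds hx.1 hx.2))
    (((hu''.mul hvc).sub (huc.mul hv'')).intervalIntegrable_of_Icc hab)

/-- The Lippmann–Schwinger identity: if `u` solves the Schrödinger equation
`-u'' + p u + λ u = f` and `u⁰` solves the background equation
`-(u⁰)'' + λ u⁰ = f` on `[0, L]`, both with Neumann boundary conditions, then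
`∫₀ᴸ f u⁰ − ∫₀ᴸ f u = ∫₀ᴸ p u u⁰`. -/
theorem lippmann_schwinger_identity
    (L : ℝ) (hL : 0 < L) (p f : ℝ → ℝ)
    (hp : ContinuousOn p (Set.Icc 0 L)) (hf : ContinuousOn f (Set.Icc 0 L))
    (lam : ℝ) (u u' u'' u0 u0' u0'' : ℝ → ℝ)
    (hu' : ∀ x ∈ Set.Icc 0 L, HasDerivWithinAt u (u' x) (Set.Icc 0 L) x)
    (hu'' : ∀ x ∈ Set.Icc 0 L, HasDerivWithinAt u' (u'' x) (Set.Icc 0 L) x)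
    (hu''c : ContinuousOn u'' (Set.Icc 0 L))
    (hu0' : ∀ x ∈ Set.Icc 0 L, HasDerivWithinAt u0 (u0' x) (Set.Icc 0 L) x)
    (hu0'' : ∀ x ∈ Set.Icc 0 L, HasDerivWithinAt u0' (u0'' x) (Set.Icc 0 L) x)
    (hu0''c : ContinuousOn u0'' (Set.Icc 0 L))
    (heq : ∀ x ∈ Set.Icc 0 L, -u'' x + p x * u x + lam * u x = f x)
    (heq0 : ∀ x ∈ Set.Icc 0 L, -u0'' x + lam * u0 x = f x)
    (hbu0 : u' 0 = 0) (hbuL : u' L = 0) (hbu00 : u0' 0 = 0) (hbu0L : u0' L = 0) :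
    (∫ x in (0:ℝ)..L, f x * u0 x) - (∫ x in (0:ℝ)..L, f x * u x) =
      ∫ x in (0:ℝ)..L, p x * u x * u0 x := by
  have huc : ContinuousOn u (Set.Icc 0 L) := HasDerivWithinAt.continuousOn hu'
  have hu0c : ContinuousOn u0 (Set.Icc 0 L) := HasDerivWithinAt.continuousOn hu0'
  have hW : ∫ x in (0:ℝ)..L, (u'' x * u0 x - u x * u0'' x) = 0 := by
    rw [integral_deriv_deriv_mul_sub_mul_deriv_deriv hL.le hu' hu'' hu''c hu0' hu0'' hu0''c,
      hbu0, hbuL, hbu00, hbu0L]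
    ring
  have hWint : IntervalIntegrable (fun x => u'' x * u0 x - u x * u0'' x) MeasureTheory.volume 0 L :=
    ((hu''c.mul hu0c).sub (huc.mul hu0''c)).intervalIntegrable_of_Icc hL.le
  have hpint : IntervalIntegrable (fun x => p x * u x * u0 x) MeasureTheory.volume 0 L :=
    ((hp.mul huc).mul hu0c).intervalIntegrable_of_Icc hL.le
  have hsub : ∫ x in (0:ℝ)..L, (p x * u x * u0 x - (u'' x * u0 x - u x * u0'' x)) =
      ∫ x in (0:ℝ)..L, p x * u x * u0 x := by
    rw [intervalIntegral.integral_sub hpint hWint, hW, sub_zero]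
  rw [← intervalIntegral.integral_sub ((hf.fun_mul hu0c).intervalIntegrable_of_Icc hL.le)
      ((hf.fun_mul huc).intervalIntegrable_of_Icc hL.le), ← hsub]
  refine intervalIntegral.integral_congr fun x hx => ?_
  rw [Set.uIcc_of_le hL.le] at hx
  linear_combination u x * heq0 x hx - u0 x * heq x hx
end

section
/- Let E be a real inner product space, A : E → E a linear map that is symmetric (⟨A x, y⟩ = ⟨x, A y⟩ for all x, y ∈ E), f ∈ E, and let λᵢ, λⱼ ∈ ℝ with elements uᵢ, uⱼ ∈ E satisfying A uᵢ + λᵢ uᵢ = f and A uⱼ + λⱼ uⱼ = f. Set F(λᵢ) = ⟨f, uᵢ⟩ and F(λⱼ) = ⟨f, uⱼ⟩. Then (λᵢ − λⱼ) ⟨uᵢ, uⱼ⟩ = F(λⱼ) − F(λᵢ); in particular, if λᵢ ≠ λⱼ then the mass matrix entry Mᵢⱼ = ⟨uᵢ, uⱼ⟩ equals (F(λⱼ) − F(λᵢ)) / (λᵢ − λⱼ). -/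
open scoped RealInnerProductSpace

/-- Loewner framework formula for off-diagonal mass matrix entries:
`(λᵢ − λⱼ) ⟨uᵢ, uⱼ⟩ = F(λⱼ) − F(λᵢ)` where `F(λₖ) = ⟨f, uₖ⟩` and
`A uₖ + λₖ uₖ = f`, for a symmetric linear map `A`. -/
theorem mass_matrix_loewner
    {E : Type*} [NormedAddCommGroup E] [InnerProductSpace ℝ E]
    (A : E →ₗ[ℝ] E) (hA : ∀ x y : E, ⟪A x, y⟫ = ⟪x, A y⟫)
    (f : E) (li lj : ℝ) (ui uj : E)
    (hi : A ui + li • ui = f) (hj : A uj + lj • uj = f) :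
    (li - lj) * ⟪ui, uj⟫ = ⟪f, uj⟫ - ⟪f, ui⟫ ∧
      (li ≠ lj → ⟪ui, uj⟫ = (⟪f, uj⟫ - ⟪f, ui⟫) / (li - lj)) := by
  have key : (li - lj) * ⟪ui, uj⟫ = ⟪f, uj⟫ - ⟪f, ui⟫ := by
    have h₁ : ⟪f, uj⟫ = ⟪A ui, uj⟫ + li * ⟪ui, uj⟫ := by
      rw [← hi, inner_add_left, real_inner_smul_left]
    have h₂ : ⟪f, ui⟫ = ⟪A ui, uj⟫ + lj * ⟪ui, uj⟫ := by
      rw [real_inner_comm, ← hj, inner_add_right, real_inner_smul_right, hA]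
    rw [h₁, h₂]
    ring
  exact ⟨key, fun h => by rw [← key, mul_div_cancel_left₀ _ (sub_ne_zero.mpr h)]⟩
end

section
/- Let E be a real inner product space, A : E → E a linear map that is symmetric (⟨A x, y⟩ = ⟨x, A y⟩ for all x, y ∈ E), f ∈ E, and let λᵢ, λⱼ ∈ ℝ with elements uᵢ, uⱼ ∈ E satisfying A uᵢ + λᵢ uᵢ = f and A uⱼ + λⱼ uⱼ = f. Set F(λᵢ) = ⟨f, uᵢ⟩ and F(λⱼ) = ⟨f, uⱼ⟩. Then (λᵢ − λⱼ) ⟨uᵢ, A uⱼ⟩ = λᵢ F(λᵢ) − λⱼ F(λⱼ); in particular, if λᵢ ≠ λⱼ then the stiffness matrix entry Sᵢⱼ = ⟨uᵢ, A uⱼ⟩ equals (λᵢ F(λᵢ) − λⱼ F(λⱼ)) / (λᵢ − λⱼ). -/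
open scoped RealInnerProductSpace

/-- Loewner framework formula for off-diagonal stiffness matrix entries:
`(λᵢ − λⱼ) ⟨uᵢ, A uⱼ⟩ = λᵢ F(λᵢ) − λⱼ F(λⱼ)` where `F(λₖ) = ⟨f, uₖ⟩` and
`A uₖ + λₖ uₖ = f`, for a symmetric linear map `A`. -/
theorem stiffness_matrix_loewner
    {E : Type*} [NormedAddCommGroup E] [InnerProductSpace ℝ E]
    (A : E →ₗ[ℝ] E) (hA : ∀ x y : E, ⟪A x, y⟫ = ⟪x, A y⟫)
    (f : E) (li lj : ℝ) (ui uj : E)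
    (hi : A ui + li • ui = f) (hj : A uj + lj • uj = f) :
    (li - lj) * ⟪ui, A uj⟫ = li * ⟪f, ui⟫ - lj * ⟪f, uj⟫ ∧
      (li ≠ lj → ⟪ui, A uj⟫ = (li * ⟪f, ui⟫ - lj * ⟪f, uj⟫) / (li - lj)) := by
  have hfi : ⟪f, ui⟫ = ⟪ui, A uj⟫ + lj * ⟪ui, uj⟫ := by
    rw [← hj, real_inner_comm, inner_add_right, real_inner_smul_right]
  have hfj : ⟪f, uj⟫ = ⟪ui, A uj⟫ + li * ⟪ui, uj⟫ := by
    rw [← hi, inner_add_left, real_inner_smul_left, hA]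
  have key : (li - lj) * ⟪ui, A uj⟫ = li * ⟪f, ui⟫ - lj * ⟪f, uj⟫ := by
    rw [hfi, hfj]
    ring
  refine ⟨key, fun hne => ?_⟩
  rw [eq_div_iff (sub_ne_zero.mpr hne), mul_comm, key]
end

section
/- Let E be a real inner product space, A : E → E a symmetric linear map (⟨A x, y⟩ = ⟨x, A y⟩ for all x, y ∈ E), f ∈ E, m a positive integer, and λ₁, …, λₘ ∈ ℝ with elements u₁, …, uₘ ∈ E satisfying A uₖ + λₖ uₖ = f for each k. Define the m × m real matrices S and M by Sᵢₖ = ⟨uᵢ, A uₖ⟩ and Mᵢₖ = ⟨uᵢ, uₖ⟩, and the vector b ∈ ℝᵐ by bᵢ = ⟨f, uᵢ⟩. Then for every j, the standard basis vector eⱼ satisfies (S + λⱼ M) eⱼ = b; consequently, if S + λⱼ M is invertible and c = (S + λⱼ M)⁻¹ b, then Σₖ cₖ uₖ = uⱼ. -/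
open scoped RealInnerProductSpace
open Matrix

/-- Galerkin interpolation property of the reduced-order model: with
`S i k = ⟨uᵢ, A uₖ⟩`, `M i k = ⟨uᵢ, uₖ⟩`, `b i = ⟨f, uᵢ⟩` built from snapshots
satisfying `A uₖ + λₖ uₖ = f`, the standard basis vector `eⱼ` solves
`(S + λⱼ M) eⱼ = b`; hence, if `S + λⱼ M` is invertible and
`c = (S + λⱼ M)⁻¹ b`, then `Σₖ cₖ uₖ = uⱼ`. -/
theorem galerkin_interpolation
    {E : Type*} [NormedAddCommGroup E] [InnerProductSpace ℝ E]
    (A : E →ₗ[ℝ] E) (hA : ∀ x y : E, ⟪A x, y⟫ = ⟪x, A y⟫)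
    (f : E) (m : ℕ) (hm : 0 < m) (lam : Fin m → ℝ) (u : Fin m → E)
    (hu : ∀ k, A (u k) + lam k • u k = f)
    (S M : Matrix (Fin m) (Fin m) ℝ) (b : Fin m → ℝ)
    (hS : ∀ i k, S i k = ⟪u i, A (u k)⟫)
    (hM : ∀ i k, M i k = ⟪u i, u k⟫)
    (hb : ∀ i, b i = ⟪f, u i⟫) (j : Fin m) :
    (S + lam j • M) *ᵥ Pi.single j 1 = b ∧
      (IsUnit (S + lam j • M) →
        ∑ k, ((S + lam j • M)⁻¹ *ᵥ b) k • u k = u j) := by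
  have h : (S + lam j • M) *ᵥ Pi.single j 1 = b := by
    ext i
    rw [mulVec_single_one, col_apply, hb, ← hu j, real_inner_comm, inner_add_right,
      real_inner_smul_right, Matrix.add_apply, Matrix.smul_apply, hS, hM, smul_eq_mul]
  refine ⟨h, fun hU => ?_⟩
  rw [← h, mulVec_mulVec, nonsing_inv_mul _ ((isUnit_iff_isUnit_det _).mp hU), one_mulVec]
  simp [Pi.single_apply]
end

section
/- Let E be a real inner product space, A : E → E a symmetric linear map (⟨A x, y⟩ = ⟨x, A y⟩ for all x, y ∈ E), f ∈ E, m a positive integer, and λ₁, …, λₘ ∈ ℝ with elements u₁, …, uₘ ∈ E satisfying A uₖ + λₖ uₖ = f for each k. Define the m × m real matrices S and M by Sᵢₖ = ⟨uᵢ, A uₖ⟩ and Mᵢₖ = ⟨uᵢ, uₖ⟩, and the vector b ∈ ℝᵐ by bᵢ = ⟨f, uᵢ⟩. If S + λⱼ M is invertible, then the reduced-order-model transfer function matches the data at λⱼ: bᵀ (S + λⱼ M)⁻¹ b = ⟨f, uⱼ⟩. -/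
open scoped RealInnerProductSpace
open Matrix

/-- Transfer-function interpolation property of the Galerkin reduced-order
model: with `S i k = ⟨uᵢ, A uₖ⟩`, `M i k = ⟨uᵢ, uₖ⟩`, `b i = ⟨f, uᵢ⟩` built
from snapshots satisfying `A uₖ + λₖ uₖ = f`, if `S + λⱼ M` is invertible then
`bᵀ (S + λⱼ M)⁻¹ b = ⟨f, uⱼ⟩`. -/
theorem rom_transfer_function_interpolation
    {E : Type*} [NormedAddCommGroup E] [InnerProductSpace ℝ E]
    (A : E →ₗ[ℝ] E) (hA : ∀ x y : E, ⟪A x, y⟫ = ⟪x, A y⟫)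
    (f : E) (m : ℕ) (hm : 0 < m) (lam : Fin m → ℝ) (u : Fin m → E)
    (hu : ∀ k, A (u k) + lam k • u k = f)
    (S M : Matrix (Fin m) (Fin m) ℝ) (b : Fin m → ℝ)
    (hS : ∀ i k, S i k = ⟪u i, A (u k)⟫)
    (hM : ∀ i k, M i k = ⟪u i, u k⟫)
    (hb : ∀ i, b i = ⟪f, u i⟫) (j : Fin m)
    (hinv : IsUnit (S + lam j • M)) :
    b ⬝ᵥ ((S + lam j • M)⁻¹ *ᵥ b) = ⟪f, u j⟫ := by
  have hcol : (S + lam j • M) *ᵥ Pi.single j 1 = b := by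
    ext i
    rw [mulVec_single_one, col_apply, Matrix.add_apply, Matrix.smul_apply, hS, hM, hb,
      ← real_inner_comm f, ← hu j, inner_add_right, real_inner_smul_right, smul_eq_mul]
  have hsolve : (S + lam j • M)⁻¹ *ᵥ b = Pi.single j 1 := by
    rw [← hcol, mulVec_mulVec, nonsing_inv_mul _ ((isUnit_iff_isUnit_det _).mp hinv), one_mulVec]
  rw [hsolve, dotProduct_single_one, hb]
end

section
/- Let H be a real Hilbert space, A : H → H a bounded self-adjoint operator, f ∈ H, m a positive integer, and λ₁, …, λₘ ∈ ℝ such that A + λₖ I is boundedly invertible for each k; set uₖ = (A + λₖ I)⁻¹ f. Define the m × m real matrices S and M by Sᵢₖ = ⟨uᵢ, A uₖ⟩ and Mᵢₖ = ⟨uᵢ, uₖ⟩, and b ∈ ℝᵐ by bᵢ = ⟨f, uᵢ⟩. If S + λⱼ M is invertible, then the function λ ↦ bᵀ (S + λ M)⁻¹ b is differentiable at λⱼ with derivative −‖uⱼ‖². -/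
open scoped RealInnerProductSpace
open Matrix

section

open scoped Matrix.Norms.Operator

/-- The derivative of the inverse of an affine matrix pencil. -/
theorem Matrix.hasDerivAt_inv_add_smul {n : Type*} [Fintype n] [DecidableEq n]
    (S M : Matrix n n ℝ) (x : ℝ) (h : IsUnit (S + x • M)) :
    HasDerivAt (fun l : ℝ => (S + l • M)⁻¹)
      (-((S + x • M)⁻¹ * M * (S + x • M)⁻¹)) x := by
  have hpencil : HasDerivAt (fun l : ℝ => S + l • M) M x := by
    have hsmul := ((hasDerivAt_id x).smul_const M).const_add S
    rw [one_smul] at hsmul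
    exact hsmul
  obtain ⟨K, hK⟩ := h
  have hinv := hasFDerivAt_ringInverse (𝕜 := ℝ) K
  rw [hK] at hinv
  have hcomp := hinv.comp_hasDerivAt x hpencil
  simp only [Function.comp_def, ← Matrix.nonsing_inv_eq_ringInverse, _root_.neg_apply,
    ContinuousLinearMap.mulLeftRight_apply, Matrix.coe_units_inv, hK] at hcomp
  exact hcomp

/-- The derivative of a bilinear form in the inverse of an affine matrix pencil. -/
theorem Matrix.hasDerivAt_dotProduct_inv_add_smul_mulVec {n : Type*} [Fintype n] [DecidableEq n]
    (S M : Matrix n n ℝ) (v w : n → ℝ) (x : ℝ) (h : IsUnit (S + x • M)) :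
    HasDerivAt (fun l : ℝ => v ⬝ᵥ ((S + l • M)⁻¹ *ᵥ w))
      (-((v ᵥ* (S + x • M)⁻¹) ⬝ᵥ (M *ᵥ ((S + x • M)⁻¹ *ᵥ w)))) x := by
  let L : Matrix n n ℝ →ₗ[ℝ] ℝ :=
    { toFun := fun B => v ⬝ᵥ (B *ᵥ w)
      map_add' := fun B C => by rw [Matrix.add_mulVec, dotProduct_add]
      map_smul' := fun c B => by rw [Matrix.smul_mulVec, dotProduct_smul]; rfl }
  have hL := L.toContinuousLinearMap.hasFDerivAt.comp_hasDerivAt x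
    (Matrix.hasDerivAt_inv_add_smul S M x h)
  have hval : L (-((S + x • M)⁻¹ * M * (S + x • M)⁻¹)) =
      -((v ᵥ* (S + x • M)⁻¹) ⬝ᵥ (M *ᵥ ((S + x • M)⁻¹ *ᵥ w))) := by
    rw [map_neg, ← Matrix.dotProduct_mulVec, Matrix.mulVec_mulVec, Matrix.mulVec_mulVec]
    simp only [L, LinearMap.coe_mk, AddHom.coe_mk, Matrix.mul_assoc]
  rw [← hval]
  exact hL

end

/-- Hermite (derivative) interpolation property of the reduced-order-model
transfer function `F_ROM(λ) = bᵀ (S + λ M)⁻¹ b` built from snapshots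
`uₖ = (A + λₖ I)⁻¹ f` of a bounded self-adjoint operator `A`: at each sample
point `λⱼ` (where `S + λⱼ M` is invertible) the derivative equals `−‖uⱼ‖²`. -/
theorem rom_transfer_function_deriv_interpolation
    {H : Type*} [NormedAddCommGroup H] [InnerProductSpace ℝ H] [CompleteSpace H]
    (A : H →L[ℝ] H) (hA : IsSelfAdjoint A) (f : H)
    (m : ℕ) (hm : 0 < m) (lam : Fin m → ℝ) (u : Fin m → H)
    (hop : ∀ k, IsUnit (A + lam k • (1 : H →L[ℝ] H)))
    (hu : ∀ k, A (u k) + lam k • u k = f)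
    (S M : Matrix (Fin m) (Fin m) ℝ) (b : Fin m → ℝ)
    (hS : ∀ i k, S i k = ⟪u i, A (u k)⟫)
    (hM : ∀ i k, M i k = ⟪u i, u k⟫)
    (hb : ∀ i, b i = ⟪f, u i⟫) (j : Fin m)
    (hinv : IsUnit (S + lam j • M)) :
    HasDerivAt (fun l : ℝ => b ⬝ᵥ ((S + l • M)⁻¹ *ᵥ b))
      (-‖u j‖ ^ 2) (lam j) := by
  have hdet : IsUnit (S + lam j • M).det := (Matrix.isUnit_iff_isUnit_det _).mp hinv
  have hsymm : (S + lam j • M)ᵀ = S + lam j • M := by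
    ext i k
    have hAik : ⟪A (u k), u i⟫ = ⟪u k, A (u i)⟫ := hA.isSymmetric (u k) (u i)
    simp only [Matrix.transpose_apply, Matrix.add_apply, Matrix.smul_apply, hS, hM]
    rw [← hAik, real_inner_comm (u i) (A (u k)), real_inner_comm (u i) (u k)]
  have hcol : (S + lam j • M) *ᵥ Pi.single j 1 = b := by
    ext i
    rw [Matrix.mulVec_single_one, Matrix.col_apply, Matrix.add_apply, Matrix.smul_apply, hS, hM,
      hb, smul_eq_mul, ← real_inner_smul_right, ← inner_add_right, hu, real_inner_comm]
  have hsol : (S + lam j • M)⁻¹ *ᵥ b = Pi.single j 1 := by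
    rw [← hcol, Matrix.mulVec_mulVec, Matrix.nonsing_inv_mul _ hdet, Matrix.one_mulVec]
  have hsol' : b ᵥ* (S + lam j • M)⁻¹ = Pi.single j 1 := by
    rw [← Matrix.mulVec_transpose, Matrix.transpose_nonsing_inv, hsymm, hsol]
  have hderiv := Matrix.hasDerivAt_dotProduct_inv_add_smul_mulVec S M b b (lam j) hinv
  rw [hsol', hsol] at hderiv
  simpa [hM] using hderiv
end
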